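/- Let r ≥ 1 and n ≥ 1 be integers, let E = (e_{ij}) be an r×n matrix of nonnegative integers, and let u_1, …, u_r ∈ F_q^*. Suppose U is an r×r unimodular integer matrix, V is an n×n unimodular integer matrix, and d_1 | d_2 | … | d_s are positive integers such that U E V is the r×n matrix whose (j,j) entry is d_j for 1 ≤ j ≤ s and whose other entries are 0. Set (h'_1, …, h'_r)^T = U · (ind_α(u_1), …, ind_α(u_r))^T. If gcd(q−1, d_j) divides h'_j for every 1 ≤ j ≤ s and (q−1) divides h'_j for every s < j ≤ r, then the number of x ∈ (F_q^*)^n satisfying ∏_{j=1}^{n} x_j^{e_{ij}} = u_i for all 1 ≤ i ≤ r equals (q−1)^{n−s} · ∏_{j=1}^{s} gcd(q−1, d_j). -/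

import Mathlib

open Finset

/-- `(U, V, d 0 ∣ d 1 ∣ ⋯ ∣ d (s-1))` is a Smith datum for the matrix `M`:
`U` and `V` are unimodular and `U * M * V` is diagonal with the positive
invariant factors `d 0 ∣ ⋯ ∣ d (s-1)` on the diagonal and zeros elsewhere. -/
def IsSmithDatum {ρ n : ℕ} (M : Matrix (Fin ρ) (Fin n) ℤ)
    (U : Matrix (Fin ρ) (Fin ρ) ℤ) (V : Matrix (Fin n) (Fin n) ℤ)
    (s : ℕ) (d : ℕ → ℕ) : Prop :=
  IsUnit U.det ∧ IsUnit V.det ∧ s ≤ ρ ∧ s ≤ n ∧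
    (∀ j, j < s → 0 < d j) ∧ (∀ j, j + 1 < s → d j ∣ d (j + 1)) ∧
    ∀ i k, (U * M * V) i k =
      if (i : ℕ) = (k : ℕ) ∧ (i : ℕ) < s then (d (i : ℕ) : ℤ) else 0

/-- The index condition: writing `h' = U ⬝ w` (where `w` is the vector of
indices of the `uᵢ`), one has `gcd (m, d j) ∣ h'_j` for `j < s` and
`m ∣ h'_j` for `s ≤ j`. Here `m` plays the role of `q - 1`. -/
def IndexCond {ρ : ℕ} (m : ℕ) (U : Matrix (Fin ρ) (Fin ρ) ℤ)
    (s : ℕ) (d : ℕ → ℕ) (w : Fin ρ → ℤ) : Prop :=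
  ∀ j : Fin ρ,
    (if (j : ℕ) < s then ((Nat.gcd m (d (j : ℕ))) : ℤ) else (m : ℤ)) ∣ (U.mulVec w) j

/-- In `ZMod m`, the equation `d • z = c` has `gcd m d` solutions as soon as it has one, which is
the case when `gcd m d ∣ c`. -/
theorem ZMod.card_mul_eq_intCast {m : ℕ} [NeZero m] {d : ℕ} {c : ℤ}
    (h : ((Nat.gcd m d : ℕ) : ℤ) ∣ c) :
    Nat.card {z : ZMod m // (d : ZMod m) * z = (c : ZMod m)} = Nat.gcd m d := by
  obtain ⟨k, rfl⟩ := h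
  have hsol : (nsmulAddMonoidHom d : ZMod m →+ ZMod m) ((Nat.gcdB m d * k : ℤ) : ZMod m) =
      ((((Nat.gcd m d : ℕ) : ℤ) * k : ℤ) : ZMod m) := by
    rw [Nat.gcd_eq_gcd_ab]
    simp [mul_assoc]
  have hker := IsAddCyclic.card_nsmulAddMonoidHom_ker (ZMod m) d
  rw [Nat.card_zmod] at hker
  refine (Nat.card_congr ((Equiv.subtypeEquivRight fun z => ?_).trans
    ((nsmulAddMonoidHom d : ZMod m →+ ZMod m).fiberEquivKer
      ((Nat.gcdB m d * k : ℤ) : ZMod m)))).trans hker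
  rw [hsol]
  simp

/-- Multiplying by invertible matrices on both sides does not change the number of solutions of a
linear system. -/
theorem Matrix.card_mulVec_eq_of_isUnit {R ι κ : Type*} [CommRing R] [Fintype ι] [DecidableEq ι]
    [Fintype κ] [DecidableEq κ] (M : Matrix ι κ R) (w : ι → R) {U : Matrix ι ι R}
    {V : Matrix κ κ R} (hU : IsUnit U) (hV : IsUnit V) :
    Nat.card {y : κ → R // M.mulVec y = w} =
      Nat.card {z : κ → R // (U * M * V).mulVec z = U.mulVec w} := by
  have hbij : Function.Bijective V.mulVec :=
    ⟨Matrix.mulVec_injective_of_isUnit hV, Matrix.mulVec_surjective_iff_isUnit.mpr hV⟩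
  refine (Nat.card_congr ((Equiv.ofBijective _ hbij).subtypeEquiv fun z => ?_)).symm
  rw [Equiv.ofBijective_apply, ← Matrix.mulVec_mulVec, ← Matrix.mulVec_mulVec]
  exact (Matrix.mulVec_injective_of_isUnit hU).eq_iff

/-- The number of solutions of a diagonal linear system over `ZMod m`. -/
theorem ZMod.card_mulVec_eq_of_diagonal {m r n s : ℕ} [NeZero m] (hr : s ≤ r) (hn : s ≤ n)
    (d : ℕ → ℕ) (D : Matrix (Fin r) (Fin n) (ZMod m))
    (hD : ∀ i k, D i k = if (i : ℕ) = (k : ℕ) ∧ (i : ℕ) < s then (d (i : ℕ) : ZMod m) else 0)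
    (c : Fin r → ℤ)
    (hc : ∀ j : Fin r, (if (j : ℕ) < s then (Nat.gcd m (d (j : ℕ)) : ℤ) else (m : ℤ)) ∣ c j) :
    Nat.card {z : Fin n → ZMod m // D.mulVec z = fun i => (c i : ZMod m)} =
      m ^ (n - s) * ∏ j ∈ Finset.range s, Nat.gcd m (d j) := by
  have hrow : ∀ (z : Fin n → ZMod m) (i : Fin r), D.mulVec z i =
      if h : (i : ℕ) < s then (d i : ZMod m) * z ⟨i, h.trans_le hn⟩ else 0 := by
    intro z i
    simp only [Matrix.mulVec, dotProduct, hD]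
    split_ifs with h
    · rw [Finset.sum_eq_single (⟨i, h.trans_le hn⟩ : Fin n)]
      · simp [h]
      · intro k _ hk
        rw [if_neg, zero_mul]
        rintro ⟨hik, -⟩
        exact hk (Fin.ext hik.symm)
      · simp
    · simp [h]
  have hiff : ∀ z : Fin n → ZMod m, D.mulVec z = (fun i => (c i : ZMod m)) ↔
      ∀ k : Fin n, ∀ h : (k : ℕ) < s, (d k : ZMod m) * z k = (c ⟨k, h.trans_le hr⟩ : ZMod m) := by
    intro z
    refine ⟨fun hz k h => ?_, fun hz => funext fun i => ?_⟩
    · have := congrFun hz ⟨k, h.trans_le hr⟩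
      rwa [hrow, dif_pos h] at this
    · rw [hrow]
      split_ifs with h
      · exact hz ⟨i, h.trans_le hn⟩ h
      · have := hc i
        rw [if_neg h] at this
        exact ((ZMod.intCast_zmod_eq_zero_iff_dvd _ _).mpr this).symm
  rw [Nat.card_congr (Equiv.subtypeEquivRight hiff),
    Nat.card_congr (Equiv.subtypePiEquivPi (p := fun (k : Fin n) (x : ZMod m) =>
      ∀ h : (k : ℕ) < s, (d k : ZMod m) * x = (c ⟨k, h.trans_le hr⟩ : ZMod m))), Nat.card_pi]
  have hfactor : ∀ k : Fin n, Nat.card {x : ZMod m //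
      ∀ h : (k : ℕ) < s, (d k : ZMod m) * x = (c ⟨k, h.trans_le hr⟩ : ZMod m)} =
      if (k : ℕ) < s then Nat.gcd m (d k) else m := by
    intro k
    split_ifs with h
    · have := hc ⟨k, h.trans_le hr⟩
      rw [if_pos h] at this
      simpa [h] using ZMod.card_mul_eq_intCast this
    · simp [h]
  obtain ⟨t, rfl⟩ := Nat.exists_eq_add_of_le hn
  rw [Finset.prod_congr rfl fun k _ => hfactor k,
    Fin.prod_univ_eq_prod_range (fun k => if k < s then Nat.gcd m (d k) else m) (s + t),
    Finset.prod_range_add, mul_comm]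
  congr 1
  · simp
  · exact Finset.prod_congr rfl fun j hj => if_pos (Finset.mem_range.mp hj)

/-- If the index condition holds, the number of solutions `x ∈ (F_q^*)^n` of
the system of monomial equations `∏_j x_j^{e_{ij}} = u_i` equals
`(q-1)^{n-s} ∏_{j≤s} gcd (q-1, d_j)`. -/
theorem monomial_system_count
    (F : Type) [Field F] [Fintype F] [DecidableEq F]
    (q : ℕ) (hq : q = Fintype.card F)
    (hqpow : ∃ p k : ℕ, Nat.Prime p ∧ Odd p ∧ 0 < k ∧ q = p ^ k)
    (α : Fˣ) (hα : ∀ β : Fˣ, β ∈ Subgroup.zpowers α)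
    (ind : Fˣ → ℕ)
    (hind : ∀ β : Fˣ, 1 ≤ ind β ∧ ind β ≤ q - 1 ∧ α ^ ind β = β)
    (r n : ℕ) (hr : 1 ≤ r) (hn : 1 ≤ n)
    (E : ℕ → ℕ → ℕ) (u : Fin r → Fˣ)
    (U : Matrix (Fin r) (Fin r) ℤ) (V : Matrix (Fin n) (Fin n) ℤ)
    (s : ℕ) (d : ℕ → ℕ)
    (hSD : IsSmithDatum
      (Matrix.of fun (i : Fin r) (j : Fin n) => (E (i : ℕ) (j : ℕ) : ℤ)) U V s d)
    (hIC : IndexCond (q - 1) U s d fun i => (ind (u i) : ℤ)) :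
    Nat.card {x : Fin n → Fˣ //
        ∀ i : Fin r, (∏ j : Fin n, x j ^ E (i : ℕ) (j : ℕ)) = u i} =
      (q - 1) ^ (n - s) * ∏ j ∈ Finset.range s, Nat.gcd (q - 1) (d j) := by
  obtain ⟨hU, hV, hsr, hsn, -, -, hdiag⟩ := hSD
  have hcard : Nat.card (Additive Fˣ) = q - 1 := by
    rw [Nat.card_congr Additive.toMul, Nat.card_units, Nat.card_eq_fintype_card, hq]
  have : NeZero (q - 1) := ⟨hcard ▸ Nat.card_pos.ne'⟩
  have hgen : ∀ x : Additive Fˣ, x ∈ AddSubgroup.zmultiples (Additive.ofMul α) := hα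
  let φ := zmodAddEquivOfGenerator hgen hcard
  have hφ : ∀ β : Fˣ, φ (ind β : ZMod (q - 1)) = Additive.ofMul β := by
    intro β
    have := zmodAddEquivOfGenerator_apply_intCast hgen hcard (ind β)
    rw [Int.cast_natCast, natCast_zsmul, ← ofMul_pow, (hind β).2.2] at this
    exact this
  let f := Int.castRingHom (ZMod (q - 1))
  let M : Matrix (Fin r) (Fin n) ℤ := Matrix.of fun i j => (E i j : ℤ)
  let w : Fin r → ℤ := fun i => (ind (u i) : ℤ)
  have hlog : Nat.card {y : Fin n → ZMod (q - 1) // (M.map f).mulVec y = f ∘ w} =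
      Nat.card {x : Fin n → Fˣ // ∀ i : Fin r, (∏ j : Fin n, x j ^ E (i : ℕ) (j : ℕ)) = u i} := by
    refine Nat.card_congr ((Equiv.piCongrRight fun _ =>
      φ.toEquiv.trans Additive.toMul).subtypeEquiv fun y => ?_)
    rw [funext_iff]
    refine forall_congr' fun i => ?_
    rw [← φ.injective.eq_iff, ← Additive.ofMul.injective.eq_iff (b := u i), ← hφ (u i)]
    simp [M, f, w, Matrix.mulVec, dotProduct, ← nsmul_eq_mul]
  have hUf : IsUnit (U.map f) := ((Matrix.isUnit_iff_isUnit_det U).mpr hU).map f.mapMatrix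
  have hVf : IsUnit (V.map f) := ((Matrix.isUnit_iff_isUnit_det V).mpr hV).map f.mapMatrix
  have hUw : (U.map f).mulVec (f ∘ w) = fun i => ((U.mulVec w i : ℤ) : ZMod (q - 1)) :=
    funext fun i => (RingHom.map_mulVec f U w i).symm
  rw [← hlog, Matrix.card_mulVec_eq_of_isUnit _ _ hUf hVf, hUw]
  refine ZMod.card_mulVec_eq_of_diagonal hsr hsn d _ (fun i k => ?_) _ hIC
  rw [← Matrix.map_mul, ← Matrix.map_mul, Matrix.map_apply, hdiag]
  split_ifs <;> simp
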